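/- Let R be a left Noetherian ring, A a finitely generated left R-module, (B_j)_{j ∈ J} a family of left R-modules, and n ≥ 0. Then there is an isomorphism of abelian groups Ext^n_R(A, ⊕_{j ∈ J} B_j) ≅ ⊕_{j ∈ J} Ext^n_R(A, B_j). -/

import Mathlib

open CategoryTheory DirectSum

universe u v w

namespace ExtSum
open Limits

section Res
variable {R : Type u} [Ring R]

structure Cover (X : ModuleCat.{u} R) where
  P : ModuleCat.{u} R
  f : P ⟶ X
  epi : Epi f
  proj : Projective P
  fin : Module.Finite R X → Module.Finite R P

theorem cover_exists (X : ModuleCat.{u} R) : Nonempty (Cover X) := by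
  by_cases h : Module.Finite R X
  · obtain ⟨k, f, hf⟩ := Module.Finite.exists_fin' R X
    exact ⟨⟨ModuleCat.of R (Fin k → R), ModuleCat.ofHom f, (ModuleCat.epi_iff_surjective _).2 hf,
      (IsProjective.iff_projective (Fin k → R)).1 inferInstance,
      fun _ => inferInstanceAs (Module.Finite R (Fin k → R))⟩⟩
  · exact ⟨⟨Projective.over X, Projective.π X, inferInstance, inferInstance, fun h' => (h h').elim⟩⟩

noncomputable def cover (X : ModuleCat.{u} R) : Cover X := (cover_exists X).some

noncomputable def dd {X Y : ModuleCat.{u} R} (f : X ⟶ Y) : (cover (kernel f)).P ⟶ X :=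
  (cover (kernel f)).f ≫ kernel.ι f

theorem dd_comp {X Y : ModuleCat.{u} R} (f : X ⟶ Y) : dd f ≫ f = 0 := by
  simp [dd]

theorem exact_dd {X Y : ModuleCat.{u} R} (f : X ⟶ Y) :
    (ShortComplex.mk (dd f) f (dd_comp f)).Exact := by
  let α : ShortComplex.mk (dd f) f (dd_comp f) ⟶ ShortComplex.mk (kernel.ι f) f (by simp) :=
    { τ₁ := (cover (kernel f)).f
      τ₂ := 𝟙 _
      τ₃ := 𝟙 _
      comm₁₂ := by simp [dd]
      comm₂₃ := by simp }
  have : Epi α.τ₁ := (cover (kernel f)).epi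
  have : IsIso α.τ₂ := by dsimp [α]; infer_instance
  have : Mono α.τ₃ := by dsimp [α]; infer_instance
  rw [ShortComplex.exact_iff_of_epi_of_isIso_of_mono α]
  apply ShortComplex.exact_of_f_is_kernel
  apply kernelIsKernel

structure Arr (R : Type u) [Ring R] where
  X : ModuleCat.{u} R
  Y : ModuleCat.{u} R
  f : X ⟶ Y

noncomputable def st (Z : ModuleCat.{u} R) : ℕ → Arr R
  | 0 => ⟨(cover Z).P, Z, (cover Z).f⟩
  | n + 1 => ⟨(cover (kernel (st Z n).f)).P, (st Z n).X, dd (st Z n).f⟩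

noncomputable def stX (Z : ModuleCat.{u} R) (n : ℕ) : ModuleCat.{u} R := (st Z n).X

noncomputable def std (Z : ModuleCat.{u} R) (n : ℕ) : stX Z (n + 1) ⟶ stX Z n := (st Z (n + 1)).f

theorem std_std (Z : ModuleCat.{u} R) (n : ℕ) : std Z (n + 1) ≫ std Z n = 0 :=
  dd_comp (st Z (n + 1)).f

noncomputable def ste (Z : ModuleCat.{u} R) : stX Z 0 ⟶ Z := (cover Z).f

instance (Z : ModuleCat.{u} R) : Epi (ste Z) := (cover Z).epi

theorem std_ste (Z : ModuleCat.{u} R) : std Z 0 ≫ ste Z = 0 :=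
  dd_comp (cover Z).f

theorem exact0 (Z : ModuleCat.{u} R) : (ShortComplex.mk (std Z 0) (ste Z) (std_ste Z)).Exact :=
  exact_dd (cover Z).f

theorem exactS (Z : ModuleCat.{u} R) (n : ℕ) :
    (ShortComplex.mk (std Z (n + 1)) (std Z n) (std_std Z n)).Exact :=
  exact_dd (st Z (n + 1)).f

noncomputable def cx (Z : ModuleCat.{u} R) : ChainComplex (ModuleCat.{u} R) ℕ :=
  ChainComplex.of (stX Z) (std Z) (std_std Z)

theorem cx_d (Z : ModuleCat.{u} R) (n : ℕ) : (cx Z).d (n + 1) n = std Z n :=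
  ChainComplex.of_d _ _ _

theorem cx_exact (Z : ModuleCat.{u} R) (n : ℕ) : (cx Z).ExactAt (n + 1) := by
  rw [HomologicalComplex.exactAt_iff' _ (n + 1 + 1) (n + 1) n (by simp) (by simp)]
  refine (ShortComplex.exact_iff_of_iso ?_).2 (exactS Z n)
  exact ShortComplex.isoMk (Iso.refl _) (Iso.refl _) (Iso.refl _)
    ((Category.id_comp _).trans ((cx_d Z (n+1)).symm.trans (Category.comp_id _).symm))
    ((Category.id_comp _).trans ((cx_d Z n).symm.trans (Category.comp_id _).symm))

theorem cx_proj (Z : ModuleCat.{u} R) (n : ℕ) : Projective ((cx Z).X n) := by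
  cases n <;> exact Cover.proj _

theorem cover_fin [IsNoetherianRing R] {X Y : ModuleCat.{u} R} (f : X ⟶ Y)
    (h : Module.Finite R X) : Module.Finite R (cover (kernel f)).P := by
  apply Cover.fin
  exact Module.Finite.of_injective (kernel.ι f).hom
    ((ModuleCat.mono_iff_injective _).1 inferInstance)

theorem cx_fin [IsNoetherianRing R] (Z : ModuleCat.{u} R) [Module.Finite R Z] (n : ℕ) :
    Module.Finite R ((cx Z).X n) := by
  have h0 : Module.Finite R ((cx Z).X 0) := (cover Z).fin inferInstance
  induction n with
  | zero => exact h0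
  | succ n ih =>
    exact cover_fin (st Z n).f ih

noncomputable def res (Z : ModuleCat.{u} R) : ProjectiveResolution Z where
  complex := cx Z
  projective := cx_proj Z
  π := (ChainComplex.toSingle₀Equiv (cx Z) Z).symm ⟨ste Z, by
          rw [cx_d]; exact std_ste Z⟩
  quasiIso := ⟨fun n => by
    cases n
    · rw [ChainComplex.quasiIsoAt₀_iff, ShortComplex.quasiIso_iff_of_zeros']
      · refine (ShortComplex.exact_and_epi_g_iff_of_iso ?_).2
          ⟨exact0 Z, inferInstanceAs (Epi (ste Z))⟩
        refine ShortComplex.isoMk (Iso.refl _) (Iso.refl _) (Iso.refl _)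
          ((Category.id_comp _).trans ((cx_d Z 0).symm.trans (Category.comp_id _).symm))
          ((Category.id_comp _).trans (Eq.trans ?_ (Category.comp_id _).symm))
        exact (ChainComplex.toSingle₀Equiv_symm_apply_f_zero (C := cx Z) (X := Z) (ste Z) _).symm
      all_goals rfl
    · rw [quasiIsoAt_iff_exactAt']
      · apply cx_exact
      · apply ChainComplex.exactAt_succ_single_obj⟩

end Res

section Hom
variable {R : Type u} [Ring R] (K : ChainComplex (ModuleCat.{u} R) ℕ)

noncomputable def F : ModuleCat.{u} R ⥤ CochainComplex (ModuleCat.{u} ℤ) ℕ where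
  obj Y := K.linearYonedaObj ℤ Y
  map {Y Y'} g :=
    { f := fun i => ((linearYoneda ℤ (ModuleCat.{u} R)).map g).app (Opposite.op (K.X i))
      comm' := fun i j _ => by
        exact (((linearYoneda ℤ (ModuleCat.{u} R)).map g).naturality (K.d j i).op).symm }
  map_id Y := by
    ext i x
    exact Category.comp_id (x : K.X i ⟶ Y)
  map_comp g h := by
    ext i x
    exact (Category.assoc (x : K.X i ⟶ _) g h).symm

instance : (F K).Additive where
  map_add {Y Y' g h} := by
    ext i x
    exact Preadditive.comp_add _ _ _ (x : K.X i ⟶ _) g h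

noncomputable abbrev G (n : ℕ) : ModuleCat.{u} R ⥤ ModuleCat.{u} ℤ :=
  F K ⋙ HomologicalComplex.homologyFunctor _ _ n

theorem G_fix (n : ℕ) {Y : ModuleCat.{u} R} (h : (G K n).obj Y) :
    ∃ z : K.X n ⟶ Y, ∀ e : Y ⟶ Y, z ≫ e = z → (G K n).map e h = h := by
  obtain ⟨c, rfl⟩ := (ModuleCat.epi_iff_surjective
    (((F K).obj Y).homologyπ n)).1 inferInstance h
  refine ⟨((F K).obj Y).iCycles n c, fun e he => ?_⟩
  have h1 : HomologicalComplex.cyclesMap ((F K).map e) n c = c := by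
    apply (ModuleCat.mono_iff_injective (((F K).obj Y).iCycles n)).1 inferInstance
    have := congr($(HomologicalComplex.cyclesMap_i ((F K).map e) n) c)
    exact this.trans he
  have := congr($(HomologicalComplex.homologyπ_naturality ((F K).map e) n) c)
  refine this.trans ?_
  exact congrArg (((F K).obj Y).homologyπ n) h1

theorem finite_factor {P : ModuleCat.{u} R} [Module.Finite R P] {J : Type u} [DecidableEq J]
    (B : J → Type u) [∀ j, AddCommGroup (B j)] [∀ j, Module R (B j)]
    (z : P ⟶ ModuleCat.of R (⨁ j, B j)) :
    ∃ s : Finset J, z ≫ (∑ j ∈ s, (ModuleCat.ofHom (DirectSum.component R J B j) ≫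
      ModuleCat.ofHom (DirectSum.lof R J B j))) = z := by
  classical
  obtain ⟨t, ht⟩ := Module.Finite.fg_top (R := R) (M := P)
  refine ⟨t.biUnion fun x => DFinsupp.support (z.hom x), ?_⟩
  apply ModuleCat.hom_ext
  apply LinearMap.ext_on ht
  intro x hx
  have key : ∀ s : Finset J, DFinsupp.support (z.hom x) ⊆ s →
      ∑ j ∈ s, DirectSum.lof R J B j (z.hom x j) = z.hom x := by
    intro s hs
    refine Eq.trans ?_ (DirectSum.sum_support_of (z.hom x))
    symm
    refine Finset.sum_subset hs ?_
    intro j _ hj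
    have : z.hom x j = 0 := by simpa using hj
    rw [this]; simp
  refine Eq.trans ?_ (key _ (Finset.subset_biUnion_of_mem
    (fun x => DFinsupp.support (z.hom x)) hx))
  rw [ModuleCat.hom_comp, ModuleCat.hom_sum]
  simp
  rfl

theorem G_sum (n : ℕ) [Module.Finite R (K.X n)] {J : Type u}
    (B : J → Type u) [∀ j, AddCommGroup (B j)] [∀ j, Module R (B j)] :
    Nonempty ((⨁ j, (G K n).obj (ModuleCat.of R (B j))) ≃+
      (G K n).obj (ModuleCat.of R (⨁ j, B j))) := by
  classical
  let i (j : J) : ModuleCat.of R (B j) ⟶ ModuleCat.of R (⨁ j, B j) :=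
    ModuleCat.ofHom (DirectSum.lof R J B j)
  let p (j : J) : ModuleCat.of R (⨁ j, B j) ⟶ ModuleCat.of R (B j) :=
    ModuleCat.ofHom (DirectSum.component R J B j)
  have ip (j : J) : i j ≫ p j = 𝟙 _ := by
    ext x
    exact DirectSum.component.lof_self R j x
  have ip' (j k : J) (h : j ≠ k) : i j ≫ p k = 0 := by
    ext x
    exact DirectSum.of_eq_of_ne (β := B) j k x (Ne.symm h)
  let Ψ : (⨁ j, (G K n).obj (ModuleCat.of R (B j))) →+ (G K n).obj (ModuleCat.of R (⨁ j, B j)) :=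
    DirectSum.toAddMonoid fun j => ((G K n).map (i j)).hom.toAddMonoidHom
  have hΨ (j : J) (x) : Ψ (DirectSum.of _ j x) = (G K n).map (i j) x :=
    DirectSum.toAddMonoid_of _ _ _
  refine ⟨AddEquiv.ofBijective Ψ ⟨?_, ?_⟩⟩
  · have hp (k : J) : ∀ x, (G K n).map (p k) (Ψ x) = x k := by
      intro x
      induction x using DirectSum.induction_on with
      | zero => simp
      | of j x =>
        rw [hΨ, ← ConcreteCategory.comp_apply, ← Functor.map_comp]
        by_cases h : j = k
        · subst h
          rw [ip, CategoryTheory.Functor.map_id, DirectSum.of_eq_same]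
          rfl
        · rw [ip' _ _ h, Functor.map_zero, DirectSum.of_eq_of_ne _ _ _ (Ne.symm h)]
          rfl
      | add x y hx hy => rw [map_add, map_add, hx, hy]; rfl
    intro x y h
    refine DFinsupp.ext fun k => ?_
    rw [← hp k x, h, hp k y]
  · intro h
    obtain ⟨z, hz⟩ := G_fix K n h
    obtain ⟨s, hs⟩ := finite_factor B z
    refine ⟨∑ j ∈ s, DirectSum.of _ j ((G K n).map (p j) h), ?_⟩
    refine Eq.trans ?_ (hz _ hs)
    rw [map_sum, Functor.map_sum]
    refine Eq.trans ?_ (congrArg (fun g => g h) (ModuleCat.hom_sum _ s)).symm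
    refine Eq.trans ?_ (LinearMap.sum_apply _ _ _).symm
    refine Finset.sum_congr rfl fun j _ => ?_
    rw [hΨ, Functor.map_comp]
    rfl

end Hom
end ExtSum



/-- Over a left Noetherian ring, for `A` finitely generated,
`Ext^n(A, ⨁ⱼ Bⱼ) ≅ ⨁ⱼ Ext^n(A, Bⱼ)` as abelian groups. -/
theorem ext_directSum_snd {R : Type u} [Ring R] [IsNoetherianRing R]
    (A : Type u) [AddCommGroup A] [Module R A] [Module.Finite R A]
    {J : Type u} (B : J → Type u) [∀ j, AddCommGroup (B j)] [∀ j, Module R (B j)] (n : ℕ) :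
    Nonempty
      ((((Ext ℤ (ModuleCat.{u} R) n).obj
          (Opposite.op (ModuleCat.of R A))).obj (ModuleCat.of R (⨁ j : J, B j))) ≃+
        ⨁ j : J, (((Ext ℤ (ModuleCat.{u} R) n).obj
          (Opposite.op (ModuleCat.of R A))).obj (ModuleCat.of R (B j)))) := by
  let P := ExtSum.res (ModuleCat.of R A)
  have : Module.Finite R (P.complex.X n) := ExtSum.cx_fin (ModuleCat.of R A) n
  obtain ⟨e⟩ := ExtSum.G_sum P.complex n B
  exact ⟨((P.isoExt (R := ℤ) n _).toLinearEquiv.toAddEquiv.trans e.symm).trans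
    (DFinsupp.mapRange.addEquiv fun j =>
      (P.isoExt (R := ℤ) n (ModuleCat.of R (B j))).toLinearEquiv.toAddEquiv.symm)⟩
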